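/- arXiv:1009.5526 — 3 statements merged into one kernel-verified Lean document; each statement's English description precedes it below -/
import Mathlib

section
/- Let G be a finite group and p the smallest prime divisor of |G|. If p ≠ 2, then Pr(G) ≠ 1/p. -/
/-- The commutativity degree of a finite group `G`. -/
noncomputable def commDeg (G : Type*) [Group G] : ℚ :=
  (Nat.card {p : G × G // p.1 * p.2 = p.2 * p.1} : ℚ) / (Nat.card G) ^ 2

open Subgroup
open scoped commutatorElement

theorem le_of_dvd_of_forall_prime_le {n p m : ℕ} (h : ∀ q : ℕ, q.Prime → q ∣ n → p ≤ q)
    (hm : m ∣ n) (hm1 : m ≠ 1) (hm0 : m ≠ 0) : p ≤ m :=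
  (h _ (Nat.minFac_prime hm1) ((Nat.minFac_dvd m).trans hm)).trans
    (Nat.minFac_le (Nat.pos_of_ne_zero hm0))

theorem sq_le_of_dvd_of_forall_prime_le {n p m : ℕ} (h : ∀ q : ℕ, q.Prime → q ∣ n → p ≤ q)
    (hm : m ∣ n) (hm1 : m ≠ 1) (hm0 : m ≠ 0) (hmp : ¬ m.Prime) : p ^ 2 ≤ m :=
  (Nat.pow_le_pow_left (h _ (Nat.minFac_prime hm1) ((Nat.minFac_dvd m).trans hm)) 2).trans
    (Nat.minFac_sq_le_self (Nat.pos_of_ne_zero hm0) hmp)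

section

variable {G : Type*} [Group G]

theorem not_prime_index_center : ¬ (center G).index.Prime := by
  intro hp
  have : Fact (Nat.card (G ⧸ center G)).Prime := ⟨hp⟩
  have : IsCyclic (G ⧸ center G) := isCyclic_of_prime_card rfl
  have h := (QuotientGroup.mk' (center G)).isMulCommutative_of_isCyclic_of_ker_le_center (by simp)
  have htop : center G = ⊤ :=
    eq_top_iff.2 fun x _ => mem_center_iff.2 fun y => h.is_comm.comm y x
  rw [htop, index_top] at hp
  exact Nat.not_prime_one hp

/-- If the commutator subgroup is central, `g ↦ ⁅x, g⁆` is a homomorphism. -/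
def commutatorHom (h : commutator G ≤ center G) (x : G) : G →* G where
  toFun g := ⁅x, g⁆
  map_one' := by simp
  map_mul' a b := by
    have hc := mem_center_iff.1 (h (commutator_mem_commutator (mem_top x) (mem_top b)))
    calc ⁅x, a * b⁆ = x * a * x⁻¹ * ⁅x, b⁆ * a⁻¹ := by
          simp only [commutatorElement_def]; group
      _ = ⁅x, a⁆ * ⁅x, b⁆ := by
          rw [mul_assoc _ _ a⁻¹, ← hc a⁻¹]; simp only [commutatorElement_def]; group

theorem commutatorHom_apply (h : commutator G ≤ center G) (x g : G) :
    commutatorHom h x g = ⁅x, g⁆ := rfl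

theorem index_centralizer_eq_card_range (h : commutator G ≤ center G) (x : G) :
    (centralizer {x}).index = Nat.card (commutatorHom h x).range := by
  rw [← index_ker]
  congr 1
  ext g
  rw [mem_centralizer_singleton_iff, MonoidHom.mem_ker, commutatorHom_apply,
    commutatorElement_eq_one_iff_mul_comm]
  exact eq_comm

theorem index_centralizer_eq_one_iff (x : G) : (centralizer {x}).index = 1 ↔ x ∈ center G := by
  rw [index_eq_one, centralizer_eq_top_iff_subset, Set.singleton_subset_iff, SetLike.mem_coe]

theorem mem_centralizer_commutator_of_index_eq [Finite G] {p : ℕ} (hp : p.Prime)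
    (hpdvd : p ∣ Nat.card G) (hmin : ∀ q : ℕ, q.Prime → q ∣ Nat.card G → p ≤ q)
    {x : G} (hx : (centralizer {x}).index = p) : x ∈ centralizer (commutator G : Set G) := by
  have h1 : Nat.card G ≠ 1 := fun h => hp.one_lt.ne' (Nat.dvd_one.1 (h ▸ hpdvd))
  have hfac : p = (Nat.card G).minFac :=
    le_antisymm (hmin _ (Nat.minFac_prime h1) (Nat.minFac_dvd _))
      (Nat.minFac_le_of_dvd hp.two_le hpdvd)
  have hnormal := normal_of_index_eq_minFac_card (hx.trans hfac)
  have : Fact p.Prime := ⟨hp⟩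
  have : IsCyclic (G ⧸ centralizer {x}) := isCyclic_of_prime_card hx
  have hle : commutator G ≤ centralizer {x} :=
    Normal.quotient_commutative_iff_commutator_le.1 inferInstance
  exact mem_centralizer_iff.2 fun y hy => mem_centralizer_singleton_iff.1 (hle hy)

theorem exists_subgroups_covering_small_classes [Finite G] {p : ℕ} (hp : p.Prime)
    (hpdvd : p ∣ Nat.card G) (hmin : ∀ q : ℕ, q.Prime → q ∣ Nat.card G → p ≤ q)
    (hlarge : ∃ x : G, p < (centralizer {x}).index) :
    ∃ A B : Subgroup G, A ≠ ⊤ ∧ p ^ 2 ≤ B.index ∧ center G ≤ A ⊓ B ∧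
      ∀ x : G, (centralizer {x}).index ≤ p → x ∈ A ∨ x ∈ B := by
  obtain ⟨w, hw⟩ := hlarge
  have hZ : center G ≠ ⊤ := fun h => by
    rw [(index_centralizer_eq_one_iff w).2 (h ▸ mem_top w)] at hw
    exact (hp.one_lt.trans hw).false
  have hZi : p ^ 2 ≤ (center G).index :=
    sq_le_of_dvd_of_forall_prime_le hmin (index_dvd_card _) (mt index_eq_one.1 hZ)
      index_ne_zero_of_finite not_prime_index_center
  have hdich (x : G) (hx : (centralizer {x}).index ≤ p) :
      x ∈ center G ∨ (centralizer {x}).index = p := by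
    rw [← index_centralizer_eq_one_iff, or_iff_not_imp_left]
    exact fun h => hx.antisymm
      (le_of_dvd_of_forall_prime_le hmin (index_dvd_card _) h index_ne_zero_of_finite)
  by_cases hD : centralizer (commutator G : Set G) = ⊤
  swap
  · refine ⟨_, center G, hD, hZi, le_inf (center_le_centralizer _) le_rfl, fun x hx => ?_⟩
    exact (hdich x hx).symm.imp_left (mem_centralizer_commutator_of_index_eq hp hpdvd hmin)
  have hcl : commutator G ≤ center G := centralizer_eq_top_iff_subset.1 hD
  by_cases hS : ∀ x : G, (centralizer {x}).index ≤ p → x ∈ center G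
  · exact ⟨center G, center G, hZ, hZi, by simp, fun x hx => Or.inl (hS x hx)⟩
  push Not at hS
  obtain ⟨x, hx, hxZ⟩ := hS
  replace hx := (hdich x hx).resolve_left hxZ
  set Q := (commutatorHom hcl x).range
  have hQ : Nat.card Q = p := by rw [← index_centralizer_eq_card_range, hx]
  have hQZ : Q ≤ center G := by
    rintro _ ⟨g, rfl⟩
    rw [commutatorHom_apply]
    exact hcl (commutator_mem_commutator (mem_top x) (mem_top g))
  have : Q.Normal := ⟨fun n hn g => by
    rw [mem_center_iff.1 (hQZ hn) g, mul_inv_cancel_right]; exact hn⟩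
  let T := (center (G ⧸ Q)).comap (QuotientGroup.mk' Q)
  have hT (y : G) : y ∈ T ↔ (commutatorHom hcl y).range ≤ Q := by
    simp only [T, mem_comap, mem_center_iff, (QuotientGroup.mk'_surjective Q).forall]
    constructor
    · rintro h _ ⟨g, rfl⟩
      rw [commutatorHom_apply, ← QuotientGroup.eq_one_iff]
      change QuotientGroup.mk' Q _ = 1
      rw [map_commutatorElement, commutatorElement_eq_one_iff_mul_comm]
      exact (h g).symm
    · intro h g
      have := h ⟨g, rfl⟩
      rw [commutatorHom_apply, ← QuotientGroup.eq_one_iff] at this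
      change QuotientGroup.mk' Q _ = 1 at this
      rw [map_commutatorElement, commutatorElement_eq_one_iff_mul_comm] at this
      exact this.symm
  have hTi : T.index = (center (G ⧸ Q)).index :=
    index_comap_of_surjective _ (QuotientGroup.mk'_surjective Q)
  have hTtop : T ≠ ⊤ := fun h => by
    have := card_le_of_le ((hT w).1 (h ▸ mem_top w))
    rw [← index_centralizer_eq_card_range, hQ] at this
    omega
  refine ⟨centralizer {x}, T, fun h => hp.ne_one (by rw [← hx, h, index_top]), ?_,
    le_inf (center_le_centralizer _) ?_, fun y hy => ?_⟩
  · refine sq_le_of_dvd_of_forall_prime_le hmin (index_dvd_card _) (mt index_eq_one.1 hTtop)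
      index_ne_zero_of_finite ?_
    rw [hTi]
    exact not_prime_index_center
  · intro z hz
    rw [hT]
    rintro _ ⟨g, rfl⟩
    rw [commutatorHom_apply,
      commutatorElement_eq_one_iff_mul_comm.2 (mem_center_iff.1 hz g).symm]
    exact one_mem Q
  · rcases hdich y hy with hyZ | hyp
    · exact Or.inl (center_le_centralizer _ hyZ)
    rw [or_iff_not_imp_left, hT]
    intro hxy
    set R := (commutatorHom hcl y).range
    have hR : Nat.card R = p := by rw [← index_centralizer_eq_card_range, hyp]
    have : Fact (Nat.card R).Prime := ⟨hR ▸ hp⟩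
    refine subgroupOf_eq_top.1 (((Q.subgroupOf R).eq_bot_or_eq_top_of_prime_card).resolve_left ?_)
    intro hbot
    have hmemR : ⁅y, x⁆ ∈ R := ⟨x, rfl⟩
    have hmemQ : ⁅y, x⁆ ∈ Q := by
      rw [← commutatorElement_inv]
      exact inv_mem ⟨y, rfl⟩
    have h1 := (subgroupOf_eq_bot.1 hbot).le_bot ⟨hmemQ, hmemR⟩
    rw [mem_bot, commutatorElement_eq_one_iff_mul_comm] at h1
    exact hxy (mem_centralizer_singleton_iff.2 h1)

theorem card_commuting_pairs_eq_sum [Fintype G] :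
    Nat.card {p : G × G // p.1 * p.2 = p.2 * p.1} =
      ∑ x : G, Nat.card (centralizer ({x} : Set G)) := by
  rw [Nat.card_congr (Equiv.subtypeProdEquivSigmaSubtype fun x y : G => x * y = y * x),
    Nat.card_sigma]
  refine Finset.sum_congr rfl fun x _ => Nat.card_congr (Equiv.subtypeEquivRight fun y => ?_)
  rw [mem_centralizer_singleton_iff]
  exact eq_comm

theorem sq_card_lt_of_index_centralizer_le [Fintype G] {p : ℕ} (hp : 1 < p)
    (h : ∀ x : G, (centralizer {x}).index ≤ p) :
    Nat.card G ^ 2 < p * ∑ x : G, Nat.card (centralizer ({x} : Set G)) := by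
  have hsum : Nat.card G ^ 2 = ∑ _x : G, Nat.card G := by
    rw [Finset.sum_const, Finset.card_univ, Nat.card_eq_fintype_card, smul_eq_mul, sq]
  rw [hsum, Finset.mul_sum]
  refine Finset.sum_lt_sum (fun x _ => ?_) ⟨1, Finset.mem_univ _, ?_⟩
  · rw [← (centralizer {x}).card_mul_index, mul_comm]
    exact Nat.mul_le_mul_right _ (h x)
  · have h1 := (centralizer {(1 : G)}).card_mul_index
    rw [(index_centralizer_eq_one_iff 1).2 (one_mem _), mul_one] at h1
    rw [h1]
    exact lt_mul_of_one_lt_left Nat.card_pos hp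

theorem add_two_le_index_centralizer [Finite G] {p : ℕ} (hp : p.Prime) (hp2 : p ≠ 2)
    (hmin : ∀ q : ℕ, q.Prime → q ∣ Nat.card G → p ≤ q) (H : Subgroup G) (hH : p < H.index) :
    p + 2 ≤ H.index := by
  by_contra hlt
  have heq : H.index = p + 1 := by omega
  have hdvd : 2 ∣ H.index := by
    rw [heq]
    exact (hp.odd_of_ne_two hp2).add_one.two_dvd
  have := hmin 2 Nat.prime_two (hdvd.trans H.index_dvd_card)
  exact hp2 (this.antisymm hp.two_le)

open Classical in
theorem sum_card_centralizer_le [Fintype G] {p : ℕ} (hp : p.Prime) (hp2 : p ≠ 2)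
    (hmin : ∀ q : ℕ, q.Prime → q ∣ Nat.card G → p ≤ q) :
    (p * (p + 2) * ∑ x : G, Nat.card (centralizer ({x} : Set G)) : ℤ) ≤
      p * Nat.card G ^ 2 +
        2 * Nat.card G * (Finset.univ.filter fun x : G => (centralizer {x}).index ≤ p).card +
        (p ^ 2 + p - 2) * Nat.card G * Nat.card (center G) := by
  have hZ : Nat.card (center G) = (Finset.univ.filter fun x : G => x ∈ center G).card := by
    rw [Nat.card_eq_fintype_card]; exact Fintype.card_subtype _
  have hpt (x : G) : (p * (p + 2) * Nat.card (centralizer ({x} : Set G)) : ℤ) ≤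
      p * Nat.card G + 2 * Nat.card G * (if (centralizer {x}).index ≤ p then 1 else 0) +
        (p ^ 2 + p - 2) * Nat.card G * (if x ∈ center G then 1 else 0) := by
    have hci : (Nat.card (centralizer {x}) * (centralizer {x}).index : ℤ) = Nat.card G := by
      exact_mod_cast (centralizer {x}).card_mul_index
    have hc : (0 : ℤ) ≤ Nat.card (centralizer {x}) := Nat.cast_nonneg _
    have hp0 : (0 : ℤ) ≤ p := Nat.cast_nonneg _
    rw [← hci]
    by_cases hxZ : x ∈ center G
    · have h1 := (index_centralizer_eq_one_iff x).2 hxZ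
      rw [if_pos hxZ, h1, if_pos hp.one_le]
      push_cast
      linarith
    · rw [if_neg hxZ]
      by_cases hxS : (centralizer {x}).index ≤ p
      · have hi : (centralizer {x}).index = p := hxS.antisymm <|
          le_of_dvd_of_forall_prime_le hmin (index_dvd_card _)
            (mt (index_centralizer_eq_one_iff x).1 hxZ) index_ne_zero_of_finite
        rw [if_pos hxS, hi]
        linarith
      · have hi := add_two_le_index_centralizer hp hp2 hmin _ (not_le.1 hxS)
        have hi' : (p + 2 : ℤ) ≤ (centralizer {x}).index := by exact_mod_cast hi
        rw [if_neg hxS]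
        have := mul_le_mul_of_nonneg_left hi' (mul_nonneg hp0 hc)
        linarith
  have hsum := Finset.sum_le_sum fun x (_ : x ∈ Finset.univ) => hpt x
  rw [Finset.sum_add_distrib, Finset.sum_add_distrib, ← Finset.mul_sum, ← Finset.mul_sum _ _ (2 * (Nat.card G : ℤ)),
    ← Finset.mul_sum _ _ ((p ^ 2 + p - 2 : ℤ) * Nat.card G), Finset.sum_boole, Finset.sum_boole, ← hZ, Finset.sum_const, Finset.card_univ,
    ← Nat.card_eq_fintype_card, nsmul_eq_mul] at hsum
  push_cast
  linarith

open Classical in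
theorem card_add_card_center_le [Fintype G] (A B : Subgroup G) (S : Finset G)
    (hZ : center G ≤ A ⊓ B) (hS : ∀ x ∈ S, x ∈ A ∨ x ∈ B) :
    S.card + Nat.card (center G) ≤ Nat.card A + Nat.card B := by
  have hcard (H : Subgroup G) : Nat.card H = (Finset.univ.filter fun x : G => x ∈ H).card := by
    rw [Nat.card_eq_fintype_card]; exact Fintype.card_subtype _
  rw [hcard A, hcard B, hcard (center G)]
  refine le_of_le_of_eq (add_le_add (Finset.card_le_card fun x hx => ?_)
    (Finset.card_le_card fun x hx => ?_)) (Finset.card_union_add_card_inter _ _)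
  · simpa using hS x hx
  · simp only [Finset.mem_filter, Finset.mem_univ, true_and] at hx
    simpa using hZ hx

end

theorem commDeg_ne_inv_smallest_odd_prime (G : Type*) [Group G] [Fintype G] (p : ℕ)
    (hp : p.Prime) (hpdvd : p ∣ Nat.card G)
    (hmin : ∀ q : ℕ, q.Prime → q ∣ Nat.card G → p ≤ q)
    (hp2 : p ≠ 2) :
    commDeg G ≠ 1 / (p : ℚ) := by
  classical
  intro h
  have hn : 0 < Nat.card G := Nat.card_pos
  have hsum : p * ∑ x : G, Nat.card (centralizer ({x} : Set G)) = Nat.card G ^ 2 := by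
    rw [commDeg, card_commuting_pairs_eq_sum, div_eq_div_iff (by positivity)
      (by exact_mod_cast hp.ne_zero)] at h
    rw [mul_comm, one_mul] at h
    exact_mod_cast h
  have hlarge : ∃ x : G, p < (centralizer {x}).index := by
    by_contra! hall
    exact (sq_card_lt_of_index_centralizer_le hp.one_lt hall).ne' hsum
  obtain ⟨A, B, hA, hB, hZ, hS⟩ := exists_subgroups_covering_small_classes hp hpdvd hmin hlarge
  have hup := sum_card_centralizer_le hp hp2 hmin
  set S := Finset.univ.filter fun x : G => (centralizer {x}).index ≤ p
  have hSZ := card_add_card_center_le A B S hZ fun x hx => hS x (Finset.mem_filter.1 hx).2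
  have hAi : p ≤ A.index := le_of_dvd_of_forall_prime_le hmin (index_dvd_card _)
    (mt index_eq_one.1 hA) index_ne_zero_of_finite
  have hAc : Nat.card A * p ≤ Nat.card G :=
    A.card_mul_index ▸ Nat.mul_le_mul_left _ hAi
  have hBc : Nat.card B * p ^ 2 ≤ Nat.card G :=
    B.card_mul_index ▸ Nat.mul_le_mul_left _ hB
  have hZB : Nat.card (center G) ≤ Nat.card B := card_le_of_le (hZ.trans inf_le_right)
  have hp3 : 3 ≤ p := by have := hp.two_le; omega
  generalize (∑ x : G, Nat.card (centralizer ({x} : Set G))) = c at hsum hup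
  generalize Nat.card G = n at *
  generalize Nat.card A = a at *
  generalize Nat.card B = b at *
  generalize Nat.card (center G) = z at *
  generalize S.card = s at *
  zify at *
  have hcancel : 2 * (n : ℤ) ≤ 2 * s + (p ^ 2 + p - 2) * z := by
    have : (n : ℤ) * (2 * n) ≤ n * (2 * s + (p ^ 2 + p - 2) * z) := by
      linear_combination hup - (p + 2) * hsum
    exact le_of_mul_le_mul_left this hn
  have h1 : (s + z : ℤ) * p ^ 2 ≤ (p + 1) * n := by
    have e1 := mul_le_mul_of_nonneg_right hSZ (sq_nonneg (p : ℤ))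
    have e2 := mul_le_mul_of_nonneg_right hAc (by positivity : (0 : ℤ) ≤ p)
    linarith
  have h2 : (z : ℤ) * p ^ 2 ≤ n :=
    (mul_le_mul_of_nonneg_right hZB (sq_nonneg (p : ℤ))).trans hBc
  have h3 : 2 * (p : ℤ) ^ 2 * n ≤ (p ^ 2 + 3 * p - 2) * n := by
    have e1 := mul_le_mul_of_nonneg_right hcancel (sq_nonneg (p : ℤ))
    have e2 := mul_le_mul_of_nonneg_left h2 (by nlinarith : (0 : ℤ) ≤ p ^ 2 + p - 4)
    linarith
  have h4 := le_of_mul_le_mul_right h3 hn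
  nlinarith
end

section
/- Let G be a finite non-abelian group and p the smallest prime divisor of |G|. Then Pr(G) > 1/p if and only if |G'| = p and G' ⊆ Z(G). -/
/-- Frobenius divisibility: the degree of an irreducible complex representation of a finite group
divides the order of the group. Irreducibility is expressed by the image of the group spanning the
full matrix algebra. -/
theorem degree_dvd_card_of_surjective_lift {G : Type*} [Group G] [Fintype G] {d : ℕ} [NeZero d]
    (ρ : G →* Matrix (Fin d) (Fin d) ℂ) (hs : Function.Surjective (MonoidAlgebra.lift ℂ _ G ρ)) :
    d ∣ Nat.card G := by
  have hd : (d : ℂ) ≠ 0 := Nat.cast_ne_zero.2 (NeZero.ne d)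
  have schur : ∀ B : Matrix (Fin d) (Fin d) ℂ,
      ∑ g, ρ g * B * ρ g⁻¹ = Matrix.scalar (Fin d) (Nat.card G * B.trace / d) := by
    intro B
    have hcomm : ∀ M, Commute M (∑ g, ρ g * B * ρ g⁻¹) := by
      intro M
      obtain ⟨x, rfl⟩ := hs M
      induction x using MonoidAlgebra.induction_linear with
      | zero => simp
      | add x y hx hy => rw [map_add]; exact hx.add_left hy
      | single h c =>
        rw [MonoidAlgebra.lift_single]
        refine Commute.smul_left ?_ c
        rw [Commute, SemiconjBy, Finset.mul_sum, Finset.sum_mul]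
        refine Fintype.sum_equiv (Equiv.mulLeft h) _ _ fun g => ?_
        have hg : ρ (h * g)⁻¹ * ρ h = ρ g⁻¹ := by
          rw [← map_mul]
          congr 1
          group
        simp only [Equiv.coe_mulLeft, map_mul, mul_assoc, hg]
    obtain ⟨c, hc⟩ := Matrix.mem_range_scalar_of_commute_single
      (fun i j _ => hcomm (Matrix.single i j 1))
    have ht := congrArg Matrix.trace hc
    rw [Matrix.trace_sum] at ht
    have : ∀ g, (ρ g * B * ρ g⁻¹).trace = B.trace := fun g => by
      rw [Matrix.trace_mul_comm, ← mul_assoc, ← map_mul]; simp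
    simp only [this] at ht
    rw [← hc]
    congr 1
    rw [eq_div_iff hd]
    simpa [Matrix.trace, mul_comm] using ht
  have orth : ∀ i j k l, ∑ g, ρ g i j * ρ g⁻¹ k l =
      if i = l ∧ j = k then (Nat.card G : ℂ) / d else 0 := by
    intro i j k l
    have := congrFun₂ (schur (Matrix.single j k 1)) i l
    rw [Matrix.sum_apply] at this
    have hg : ∀ g,
        (ρ g * (Matrix.single j k 1 : Matrix _ _ ℂ) * ρ g⁻¹ : Matrix (Fin d) (Fin d) ℂ) i l =
          ρ g i j * ρ g⁻¹ k l := fun g => by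
      simp [Matrix.mul_apply, Matrix.single_apply, ite_and]
    simp only [hg] at this
    rw [this]
    by_cases hil : i = l <;> by_cases hjk : j = k <;>
      simp [hil, hjk, Matrix.trace_single_eq_of_ne]
  let κ : G × G →* Matrix (Fin d × Fin d) (Fin d × Fin d) ℂ :=
    { toFun := fun g => Matrix.kroneckerMap (· * ·) (ρ g.1) (ρ g.2)
      map_one' := by simp
      map_mul' := fun x y => by simp [Matrix.mul_kronecker_mul] }
  let T : Matrix (Fin d × Fin d) (Fin d × Fin d) ℂ := ∑ g, κ (g, g⁻¹)
  have hT : IsIntegral ℤ (T * T) := by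
    have : T = MonoidAlgebra.lift ℤ _ (G × G) κ (∑ g, MonoidAlgebra.single (g, g⁻¹) 1) := by
      simp [T]
    rw [this, ← map_mul]
    exact (IsIntegral.of_finite ℤ _).map _
  have hTT : T * T = algebraMap ℂ _ (((Nat.card G : ℂ) / d) ^ 2) := by
    have hTa : ∀ a b, T a b = if b = a.swap then (Nat.card G : ℂ) / d else 0 := by
      rintro ⟨a, a'⟩ ⟨b, b'⟩
      have := orth a b a' b'
      have hT' : T (a, a') (b, b') = ∑ g, ρ g a b * ρ g⁻¹ a' b' := by
        simp [T, κ, Matrix.sum_apply]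
      rw [hT', this]
      exact if_congr (by grind [Prod.swap_prod_mk]) rfl rfl
    ext a b
    rw [Matrix.mul_apply]
    simp only [hTa]
    rw [Finset.sum_eq_single a.swap (fun c _ hc => by simp [hc]) (by simp)]
    simp [Matrix.algebraMap_matrix_apply, eq_comm (a := b), sq]
  rw [hTT, isIntegral_algebraMap_iff (FaithfulSMul.algebraMap_injective _ _)] at hT
  have h1 : IsIntegral ℤ (algebraMap ℚ ℂ ((Nat.card G : ℚ) / d)) := by
    simpa using IsIntegral.of_pow two_pos hT
  rw [isIntegral_algebraMap_iff (algebraMap ℚ ℂ).injective, IsIntegrallyClosed.isIntegral_iff] at h1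
  obtain ⟨y, hy⟩ := h1
  rw [eq_div_iff (Nat.cast_ne_zero.2 (NeZero.ne d))] at hy
  rw [← Int.natCast_dvd_natCast]
  rw [eq_intCast] at hy
  exact ⟨y, by rw [mul_comm]; exact_mod_cast hy.symm⟩

/-- A finite group has at most as many linear complex characters as its abelianization has
elements. -/
theorem card_le_card_abelianization_of_surjective {G : Type*} [Group G] [Fintype G] {ι : Type*}
    [Fintype ι] [DecidableEq ι]
    (f : MonoidAlgebra ℂ G →ₐ[ℂ] (ι → ℂ)) (hf : Function.Surjective f) :
    Fintype.card ι ≤ Nat.card (Abelianization G) := by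
  let φ : G →* (ι → ℂ) := (f : MonoidAlgebra ℂ G →* (ι → ℂ)).comp (MonoidAlgebra.of ℂ G)
  let F : MonoidAlgebra ℂ (Abelianization G) →ₐ[ℂ] (ι → ℂ) :=
    MonoidAlgebra.lift ℂ _ _ ((Units.coeHom _).comp (Abelianization.lift φ.toHomUnits))
  have hF : F.comp (MonoidAlgebra.mapDomainAlgHom ℂ ℂ Abelianization.of) = f := by
    ext g
    simp [F, φ]
  have hs : Function.Surjective F := by
    rw [← hF] at hf
    exact Function.Surjective.of_comp
      (g := MonoidAlgebra.mapDomainAlgHom ℂ ℂ Abelianization.of) hf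
  have := LinearMap.finrank_le_finrank_of_surjective (f := F.toLinearMap) hs
  rw [Module.finrank_fintype_fun_eq_card, (MonoidAlgebra.coeffLinearEquiv ℂ).finrank_eq] at this
  have := Fintype.ofFinite (Abelianization G)
  simp_all

theorem Matrix.exists_algHom_apply_const {k : ℕ} (hk : k = 1) :
    ∃ F : Matrix (Fin k) (Fin k) ℂ →ₐ[ℂ] ℂ, ∀ x, F (fun _ _ => x) = x := by
  subst hk
  exact ⟨AlgHom.ofLinearMap (Matrix.entryLinearMap ℂ ℂ 0 0) (by simp)
    (by simp [Matrix.mul_apply]), fun x => rfl⟩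

/-- A finite group has at most as many conjugacy classes as its complex group algebra has simple
factors. -/
theorem card_conjClasses_le_of_algEquiv_pi_matrix {G : Type*} [Group G] [Fintype G] {n : ℕ}
    {d : Fin n → ℕ} [∀ i, NeZero (d i)]
    (e : MonoidAlgebra ℂ G ≃ₐ[ℂ] Π i, Matrix (Fin (d i)) (Fin (d i)) ℂ) :
    Nat.card (ConjClasses G) ≤ n := by
  classical
  let z : (ConjClasses G → ℂ) →ₗ[ℂ] MonoidAlgebra ℂ G :=
    { toFun := fun f => ∑ g, MonoidAlgebra.single g (f (ConjClasses.mk g))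
      map_add' := fun f f' => by simp [MonoidAlgebra.single_add, Finset.sum_add_distrib]
      map_smul' := fun c f => by simp [Finset.smul_sum, MonoidAlgebra.smul_single] }
  have hz : Function.Injective z := by
    rw [← LinearMap.ker_eq_bot, LinearMap.ker_eq_bot']
    intro f hf
    ext c
    obtain ⟨g, rfl⟩ := ConjClasses.mk_surjective c
    have := congrArg (fun x => x.coeff g) hf
    simpa [z, MonoidAlgebra.coeff_sum, Finsupp.single_apply] using this
  have hc : ∀ f x, Commute x (z f) := by
    intro f x
    induction x using MonoidAlgebra.induction_linear with
    | zero => simp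
    | add x y hx hy => exact hx.add_left hy
    | single h c =>
      simp only [z, LinearMap.coe_mk, AddHom.coe_mk, Commute, SemiconjBy, Finset.mul_sum,
        Finset.sum_mul, MonoidAlgebra.single_mul_single]
      refine Fintype.sum_equiv (MulAut.conj h).toEquiv _ _ fun g => ?_
      have : ConjClasses.mk (h * g * h⁻¹) = ConjClasses.mk g :=
        (ConjClasses.mk_eq_mk_iff_isConj.2 (isConj_iff.2 ⟨h, rfl⟩)).symm
      simp [this, mul_comm]
  let ψ : (ConjClasses G → ℂ) →ₗ[ℂ] (Fin n → ℂ) :=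
    { toFun := fun f i => e (z f) i 0 0
      map_add' := fun f f' => by ext; simp
      map_smul' := fun c f => by ext; simp }
  have hψ : Function.Injective ψ := by
    rw [← LinearMap.ker_eq_bot, LinearMap.ker_eq_bot']
    intro f hf
    apply hz
    apply e.injective
    rw [map_zero, map_zero]
    ext1 i
    obtain ⟨c, hc⟩ := Matrix.mem_range_scalar_of_commute_single (M := e (z f) i)
      (fun j k _ => by
        have := (hc f (e.symm (Pi.single i (Matrix.single j k 1)))).map e
        rw [e.apply_symm_apply] at this
        simpa using! congrFun this.eq i)
    have h0 : e (z f) i 0 0 = 0 := congrFun hf i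
    rw [← hc] at h0 ⊢
    simp at h0
    simp [h0]
  have := LinearMap.finrank_le_finrank_of_injective hψ
  have := Fintype.ofFinite (ConjClasses G)
  simp_all

/-- If every prime factor of `|G|` is at least `p`, then `p² k + a ≤ |G| + p² a`, where `k` is the
number of conjugacy classes of `G` and `a` is the order of its abelianization. -/
theorem sq_mul_card_conjClasses_add_le {G : Type*} [Group G] [Fintype G] {p : ℕ} (hp : 0 < p)
    (hmin : ∀ q : ℕ, q.Prime → q ∣ Nat.card G → p ≤ q) :
    p ^ 2 * Nat.card (ConjClasses G) + Nat.card (Abelianization G) ≤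
      Nat.card G + p ^ 2 * Nat.card (Abelianization G) := by
  classical
  obtain ⟨n, d, hd, ⟨e⟩⟩ := IsSemisimpleRing.exists_algEquiv_pi_matrix_of_isAlgClosed ℂ
    (MonoidAlgebra ℂ G)
  have h1 := card_conjClasses_le_of_algEquiv_pi_matrix e
  have h2 : Fintype.card {i // d i = 1} ≤ Nat.card (Abelianization G) := by
    choose E hE using fun i : {i // d i = 1} => Matrix.exists_algHom_apply_const i.2
    let F : ∀ i : {i // d i = 1}, (Π i, Matrix (Fin (d i)) (Fin (d i)) ℂ) →ₐ[ℂ] ℂ := fun i =>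
      (E i).comp (Pi.evalAlgHom ℂ _ i.1)
    refine card_le_card_abelianization_of_surjective ((AlgHom.pi F).comp (e : _ →ₐ[ℂ] _)) ?_
    refine Function.Surjective.comp (g := AlgHom.pi F) ?_ e.surjective
    intro v
    refine ⟨fun i => if h : d i = 1 then fun _ _ => v ⟨i, h⟩ else 0, ?_⟩
    ext i
    simp [F, i.2, hE]
  have h3 : ∑ i, d i ^ 2 = Nat.card G := by
    have := e.toLinearEquiv.finrank_eq
    rw [(MonoidAlgebra.coeffLinearEquiv ℂ).finrank_eq] at this
    simpa [Module.finrank_pi_fintype, Module.finrank_matrix, sq] using this.symm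
  have h4 : ∀ i, d i ≠ 1 → p ≤ d i := by
    intro i hi
    let φ : G →* Matrix (Fin (d i)) (Fin (d i)) ℂ :=
      MonoidHom.comp
        (((Pi.evalAlgHom ℂ (fun i => Matrix (Fin (d i)) (Fin (d i)) ℂ) i).comp e.toAlgHom) :
          MonoidAlgebra ℂ G →* _) (MonoidAlgebra.of ℂ G)
    have hφ : MonoidAlgebra.lift ℂ _ G φ =
        (Pi.evalAlgHom ℂ (fun i => Matrix (Fin (d i)) (Fin (d i)) ℂ) i).comp e.toAlgHom := by
      ext g : 2
      simp [φ]
    have : d i ∣ Nat.card G := degree_dvd_card_of_surjective_lift φ (by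
      rw [hφ]
      exact (Function.surjective_eval i).comp e.surjective)
    exact (hmin _ (Nat.minFac_prime hi) ((Nat.minFac_dvd _).trans this)).trans
      (Nat.minFac_le (NeZero.pos _))
  have h5 : p ^ 2 * n + Fintype.card {i // d i = 1} ≤
      Nat.card G + p ^ 2 * Fintype.card {i // d i = 1} := by
    have : ∀ i, p ^ 2 + (if d i = 1 then 1 else 0) ≤
        d i ^ 2 + p ^ 2 * (if d i = 1 then 1 else 0) := by
      intro i
      split_ifs with h
      · simp [h, add_comm]
      · simpa using Nat.pow_le_pow_left (h4 i h) 2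
    have := Finset.sum_le_sum (s := Finset.univ) fun i _ => this i
    rw [Finset.sum_add_distrib, Finset.sum_add_distrib, ← Finset.mul_sum, h3] at this
    simpa [-mul_ite, Fintype.card_subtype, mul_comm] using this
  have h6 : 1 ≤ p ^ 2 := Nat.one_le_pow _ _ hp
  nlinarith

/-- A normal subgroup of order at most the smallest prime factor of the group order is central. -/
theorem Subgroup.Normal.le_center_of_card_le {G : Type*} [Group G] [Fintype G] {p : ℕ}
    (hmin : ∀ q : ℕ, q.Prime → q ∣ Nat.card G → p ≤ q) (H : Subgroup G) [hH : H.Normal]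
    (hc : Nat.card H ≤ p) :
    H ≤ Subgroup.center G := by
  intro c hcm
  by_cases h1 : c = 1
  · exact h1 ▸ one_mem _
  have : Nonempty (MulAction.orbit (ConjAct G) c) := ⟨_, MulAction.mem_orbit_self c⟩
  have hsub : MulAction.orbit (ConjAct G) c ⊆ (H : Set G) \ {1} := by
    rintro _ ⟨g, rfl⟩
    refine ⟨hH.conj_mem _ hcm (ConjAct.ofConjAct g), ?_⟩
    simpa [ConjAct.smul_def] using h1
  have hcard : Nat.card (MulAction.orbit (ConjAct G) c) < p := by
    refine lt_of_lt_of_le ?_ hc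
    exact Set.ncard_lt_ncard
      (LE.le.trans_ssubset hsub (Set.sdiff_singleton_ssubset.2 (one_mem H)))
  have hdvd : Nat.card (MulAction.orbit (ConjAct G) c) ∣ Nat.card G := by
    rw [Nat.card_coe_set_eq, ← MulAction.index_stabilizer]
    exact Subgroup.index_dvd_card _
  have : Nat.card (MulAction.orbit (ConjAct G) c) = 1 := by
    by_contra h
    exact absurd (hmin _ (Nat.minFac_prime h) ((Nat.minFac_dvd _).trans hdvd))
      (not_le.2 ((Nat.minFac_le Nat.card_pos).trans_lt hcard))
  rw [Nat.card_eq_one_iff_unique] at this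
  rw [Subgroup.mem_center_iff]
  intro g
  have := congrArg Subtype.val (this.1.elim ⟨_, MulAction.mem_orbit c
    (ConjAct.toConjAct g)⟩ ⟨_, MulAction.mem_orbit_self c⟩)
  simpa [ConjAct.smul_def, mul_inv_eq_iff_eq_mul] using this

theorem commDeg_gt_inv_smallest_prime_iff (G : Type*) [Group G] [Fintype G]
    (hG : ¬ (∀ a b : G, a * b = b * a)) (p : ℕ)
    (hp : p.Prime) (hpdvd : p ∣ Nat.card G)
    (hmin : ∀ q : ℕ, q.Prime → q ∣ Nat.card G → p ≤ q) :
    commDeg G > 1 / (p : ℚ) ↔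
      Nat.card (commutator G) = p ∧ commutator G ≤ Subgroup.center G := by
  have hprob : commDeg G = Nat.card (ConjClasses G) / Nat.card G := commProb_def' G
  have hcard : Nat.card G = Nat.card (Abelianization G) * Nat.card (commutator G) :=
    Subgroup.card_eq_card_quotient_mul_card_subgroup _
  have hp0 : 0 < p := hp.pos
  have hGpos : 0 < Nat.card G := Nat.card_pos
  have hapos : 0 < Nat.card (Abelianization G) := Nat.card_pos
  have hiff : commDeg G > 1 / (p : ℚ) ↔ Nat.card G < p * Nat.card (ConjClasses G) := by
    rw [hprob, gt_iff_lt, div_lt_div_iff₀ (by positivity) (by positivity), one_mul, mul_comm]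
    norm_cast
  have hne : commutator G ≠ ⊥ := fun h => hG fun a b => by
    have := Subgroup.commutator_mem_commutator (Subgroup.mem_top a) (Subgroup.mem_top b)
    rw [← commutator_def, h, Subgroup.mem_bot, commutatorElement_eq_one_iff_mul_comm] at this
    exact this
  rw [hiff]
  constructor
  · intro h
    have hle : Nat.card (commutator G) ≤ p := by
      have hm := sq_mul_card_conjClasses_add_le hp0 hmin
      by_contra! hlt
      rw [hcard] at h hm
      obtain ⟨q, rfl⟩ : ∃ q, p = q + 1 := ⟨p - 1, by omega⟩
      nlinarith [Nat.mul_le_mul_left (q * Nat.card (Abelianization G)) hlt]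
    refine ⟨hle.antisymm ?_, Subgroup.Normal.le_center_of_card_le hmin _ hle⟩
    have h1 : Nat.card (commutator G) ≠ 1 := fun h => hne (Subgroup.card_eq_one.1 h)
    exact (hmin _ (Nat.minFac_prime h1) ((Nat.minFac_dvd _).trans
      (Subgroup.card_subgroup_dvd_card _))).trans
      (Nat.minFac_le Nat.card_pos)
  · rintro ⟨h, -⟩
    rw [hcard, h, mul_comm]
    refine Nat.mul_lt_mul_of_pos_left ?_ hp0
    have hab : Nat.card (ConjClasses (Abelianization G)) = Nat.card (Abelianization G) :=
      Nat.card_congr ConjClasses.mkEquiv.symm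
    rw [← hab]
    have hsurj : Function.Surjective (ConjClasses.map (Abelianization.of (G := G))) :=
      ConjClasses.map_surjective QuotientGroup.mk_surjective
    refine (Nat.card_le_card_of_surjective _ hsurj).lt_of_ne fun heq => hne ?_
    have hinj := ((Nat.bijective_iff_surjective_and_card _).2 ⟨hsurj, heq.symm⟩).1
    rw [Subgroup.eq_bot_iff_forall]
    intro c hc
    have h1 : ConjClasses.mk c = ConjClasses.mk 1 := hinj (congrArg ConjClasses.mk
      ((QuotientGroup.eq_one_iff c).2 hc))
    exact isConj_one_left.1 (ConjClasses.mk_eq_mk_iff_isConj.1 h1)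
end

section
/- Let G be a finite group, H a normal subgroup of G, and g ∈ G. Then the function ζ̃ : G → ℂ, where ζ̃(g) is the number of pairs (h₁, g₂) ∈ H × G with [h₁, g₂] = g, is a class function of G, and ζ̃(g) = Σ_{χ ∈ Irr(G)} (|H|·[χ|_H, χ|_H]/χ(1))·χ(g). -/
open CategoryTheory

/-- The number of pairs `(h₁, g₂) ∈ H × G` with `h₁ * g₂ * h₁⁻¹ * g₂⁻¹ = g`. -/
noncomputable def zetaTilde {G : Type} [Group G] (H : Subgroup G) (g : G) : ℕ :=
  Nat.card {p : H × G // (p.1 : G) * p.2 * (p.1 : G)⁻¹ * p.2⁻¹ = g}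

/-- The inner product `[χ|_H, χ|_H]` of the restriction to `H` of a complex character `χ`. -/
noncomputable def restInner {G : Type} [Group G] (H : Subgroup G) [Fintype H]
    (χ : G → ℂ) : ℂ :=
  (1 / (Nat.card H : ℂ)) * ∑ h : H, χ h * χ ((h : G)⁻¹)

open Representation in
/-- Schur's lemma: an equivariant endomorphism of a simple representation is the scalar determined
by its trace. -/
theorem FDRep.eq_smul_id_of_simple {G : Type} [Group G] (W : FDRep ℂ G) [Simple W]
    (T : W →ₗ[ℂ] W) (hT : ∀ g, W.ρ g ∘ₗ T = T ∘ₗ W.ρ g) :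
    T = (LinearMap.trace ℂ W T / W.character 1) • LinearMap.id := by
  have h1 : Module.finrank ℂ (invariants (linHom W.ρ W.ρ)) = 1 := by
    rw [(linHom.invariantsEquivFDRepHom W W).finrank_eq]
    exact finrank_endomorphism_simple_eq_one ℂ W
  have hmem : ∀ S : W →ₗ[ℂ] W, (∀ g, W.ρ g ∘ₗ S = S ∘ₗ W.ρ g) →
      S ∈ invariants (linHom W.ρ W.ρ) := fun S hS g => by
    rw [linHom_apply, ← LinearMap.comp_assoc, hS, LinearMap.comp_assoc, ← Module.End.mul_eq_comp,
      ← Module.End.mul_eq_comp, ← map_mul, mul_inv_cancel, map_one, mul_one]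
  have hW : Nontrivial W := by
    by_contra h
    rw [not_nontrivial_iff_subsingleton] at h
    rw [Module.finrank_zero_of_subsingleton] at h1
    exact zero_ne_one h1
  have hdim : (Module.finrank ℂ W : ℂ) ≠ 0 := Nat.cast_ne_zero.2 Module.finrank_pos.ne'
  have hid : (⟨LinearMap.id, hmem _ fun g => rfl⟩ : invariants (linHom W.ρ W.ρ)) ≠ 0 := by
    intro h
    obtain ⟨v, hv⟩ := exists_ne (0 : W)
    exact hv (LinearMap.congr_fun (congrArg Subtype.val h) v)
  obtain ⟨c, hc⟩ := (finrank_eq_one_iff_of_nonzero' _ hid).1 h1 ⟨T, hmem T hT⟩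
  have hc : T = c • LinearMap.id := (congrArg Subtype.val hc).symm
  rw [FDRep.char_one, hc, map_smul, LinearMap.trace_id, smul_eq_mul, mul_div_cancel_right₀ _ hdim]

/-- An irreducible representation is simple in the categorical sense. -/
theorem FDRep.simple_of_isIrreducible {G : Type} [Group G] [Fintype G] {V : Type}
    [AddCommGroup V] [Module ℂ V] [Module.Finite ℂ V] (ρ : Representation ℂ G V)
    [ρ.IsIrreducible] : Simple (FDRep.of ρ) := by
  have := invertibleOfNonzero (NeZero.ne (Nat.card G : ℂ))
  rw [FDRep.simple_iff_char_is_norm_one]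
  have h := ρ.card_inv_mul_sum_char_mul_char_eq_finrank ρ
  rw [Representation.IsIrreducible.finrank_intertwiningMap_self, Nat.cast_one,
    inv_mul_eq_one₀ (NeZero.ne _)] at h
  exact h.symm

/-- An element of the group algebra acting as zero on every simple `FDRep` acts as zero on every
irreducible representation. -/
theorem Representation.IsIrreducible.asAlgebraHom_eq_zero_of_forall_simple {G : Type} [Group G]
    [Fintype G] (a : MonoidAlgebra ℂ G)
    (ha : ∀ W : FDRep ℂ G, Simple W → Representation.asAlgebraHom W.ρ a = 0) {V : Type}
    [AddCommGroup V] [Module ℂ V] [Module.Finite ℂ V] (ρ : Representation ℂ G V)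
    [ρ.IsIrreducible] : ρ.asAlgebraHom a = 0 := by
  have h := ha _ (FDRep.simple_of_isIrreducible ρ)
  ext v
  have hv := LinearMap.congr_fun h v
  simp only [Representation.asAlgebraHom_def, MonoidAlgebra.lift_apply] at hv ⊢
  rw [FDRep.of_ρ'] at hv
  exact hv

open scoped MonoidAlgebra in
/-- An element of the group algebra acting as zero on every simple `FDRep` annihilates every
finitely generated simple module. -/
theorem MonoidAlgebra.smul_eq_zero_of_forall_simple {G : Type} [Group G] [Fintype G] (a : ℂ[G])
    (ha : ∀ W : FDRep ℂ G, Simple W → Representation.asAlgebraHom W.ρ a = 0)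
    (M : Type) [AddCommGroup M] [Module ℂ[G] M] [Module.Finite ℂ[G] M] [IsSimpleModule ℂ[G] M]
    (m : M) : a • m = 0 := by
  have : Module.Finite ℂ ℂ[G] := .equiv (MonoidAlgebra.coeffLinearEquiv ℂ).symm
  have : Module.Finite ℂ (RestrictScalars ℂ ℂ[G] M) := by
    let : Module ℂ[G] (RestrictScalars ℂ ℂ[G] M) := RestrictScalars.moduleOrig ℂ ℂ[G] M
    have : Module.Finite ℂ[G] (RestrictScalars ℂ ℂ[G] M) :=
      inferInstanceAs (Module.Finite ℂ[G] M)
    exact Module.Finite.trans ℂ[G] _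
  have := (Representation.isSimpleModule_iff_irreducible_ofModule (k := ℂ) (G := G) M).1
    inferInstance
  have h : (Representation.ofModule (k := ℂ) (G := G) M).asAlgebraHom a = 0 :=
    @Representation.IsIrreducible.asAlgebraHom_eq_zero_of_forall_simple G _ _ a ha
      (RestrictScalars ℂ ℂ[G] M) _ (RestrictScalars.module ℂ ℂ[G] M) ‹_›
      (Representation.ofModule (k := ℂ) (G := G) M) ‹_›
  have h2 := Representation.ofModule_asAlgebraHom_apply_apply (k := ℂ) (G := G) M a
    ((RestrictScalars.addEquiv ℂ ℂ[G] M).symm m)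
  rw [h, AddEquiv.apply_symm_apply, LinearMap.zero_apply, eq_comm,
    EmbeddingLike.map_eq_zero_iff] at h2
  exact h2

open scoped MonoidAlgebra in
/-- An element of the group algebra acting as zero on every simple representation is zero. -/
theorem MonoidAlgebra.eq_zero_of_forall_simple {G : Type} [Group G] [Fintype G] (a : ℂ[G])
    (ha : ∀ W : FDRep ℂ G, Simple W → Representation.asAlgebraHom W.ρ a = 0) : a = 0 := by
  have hann : ∀ N : Submodule ℂ[G] ℂ[G], IsSimpleModule ℂ[G] N → ∀ n ∈ N, a * n = 0 :=
    fun N _ n hn => congrArg Subtype.val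
      (MonoidAlgebra.smul_eq_zero_of_forall_simple a ha N ⟨n, hn⟩)
  have hall : ∀ n ∈ sSup {N : Submodule ℂ[G] ℂ[G] | IsSimpleModule ℂ[G] N}, a * n = 0 := by
    intro n hn
    rw [sSup_eq_iSup'] at hn
    induction hn using Submodule.iSup_induction' with
    | mem N n hn => exact hann N N.2 n hn
    | zero => exact mul_zero a
    | add x y _ _ hx hy => rw [mul_add, hx, hy, add_zero]
  rw [IsSemisimpleModule.sSup_simples_eq_top] at hall
  simpa using hall 1 trivial

/-- A class function orthogonal to all irreducible characters vanishes. -/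
theorem class_function_eq_zero_of_orthogonal {G : Type} [Group G] [Fintype G] (f : G → ℂ)
    (hf : ∀ x g, f (x * g * x⁻¹) = f g)
    (horth : ∀ W : FDRep ℂ G, Simple W → ∑ g, f g * W.character g⁻¹ = 0) : f = 0 := by
  have ha := MonoidAlgebra.eq_zero_of_forall_simple
    (∑ g, MonoidAlgebra.single g⁻¹ (f g)) fun W hW => by
      have h := (W.eq_smul_id_of_simple (∑ g, f g • W.ρ g⁻¹) fun x => by
        simp only [← Module.End.mul_eq_comp, Finset.mul_sum, Finset.sum_mul, mul_smul_comm,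
          smul_mul_assoc, ← map_mul]
        refine Fintype.sum_equiv (MulAut.conj x).toEquiv _ _ fun g => ?_
        simp [hf, ← mul_assoc])
      have ht : LinearMap.trace ℂ W (∑ g, f g • W.ρ g⁻¹) = 0 := by
        simpa [FDRep.character] using horth W hW
      rw [ht, zero_div, zero_smul] at h
      simpa [Representation.asAlgebraHom_single] using h
  funext g
  classical
  have h := congrArg (fun b : MonoidAlgebra ℂ G => b.coeff g⁻¹) ha
  simpa [Finsupp.single_apply] using h

/-- The sum of `χ (g * x * g⁻¹ * y)` over `g`, for an irreducible character `χ`. -/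
theorem FDRep.sum_character_conj_mul {G : Type} [Group G] [Fintype G] (W : FDRep ℂ G) [Simple W]
    (x y : G) : ∑ g, W.character (g * x * g⁻¹ * y) =
      Nat.card G * W.character x / W.character 1 * W.character y := by
  have h := (W.eq_smul_id_of_simple (∑ g, W.ρ (g * x * g⁻¹)) fun z => by
    simp only [← Module.End.mul_eq_comp, Finset.mul_sum, Finset.sum_mul, ← map_mul]
    refine Fintype.sum_equiv (Equiv.mulLeft z) _ _ fun g => ?_
    simp [mul_assoc])
  have ht : LinearMap.trace ℂ W (∑ g, W.ρ (g * x * g⁻¹)) = Nat.card G * W.character x := by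
    have hc : ∀ g, LinearMap.trace ℂ W (W.ρ (g * x * g⁻¹)) = W.character x :=
      fun g => W.char_conj x g
    rw [map_sum, Finset.sum_congr rfl fun g _ => hc g]
    simp
  rw [ht] at h
  have h2 := congrArg (fun T : W →ₗ[ℂ] W => LinearMap.trace ℂ W (T * W.ρ y)) h
  simp only [Finset.sum_mul, ← map_mul, map_sum, smul_mul_assoc, map_smul, smul_eq_mul] at h2
  exact h2

theorem zetaTilde_conj {G : Type} [Group G] (H : Subgroup G) [H.Normal] (x g : G) :
    zetaTilde H (x * g * x⁻¹) = zetaTilde H g := by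
  refine Nat.card_congr (Equiv.subtypeEquiv
    (((MulAut.conjNormal x⁻¹ : MulAut H).toEquiv).prodCongr (MulAut.conj x⁻¹).toEquiv) ?_)
  rintro ⟨h, k⟩
  simp only [Equiv.prodCongr_apply, Prod.map, MulEquiv.toEquiv_eq_coe, EquivLike.coe_coe,
    MulAut.conjNormal_apply, MulAut.conj_apply, inv_inv]
  constructor
  · intro e
    calc _ = x⁻¹ * ((h : G) * k * (h : G)⁻¹ * k⁻¹) * x := by group
      _ = g := by rw [e]; group
  · intro e
    rw [← e]
    group

/-- Weighted sums of `zetaTilde` are sums over commutators. -/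
theorem sum_zetaTilde_mul {G : Type} [Group G] [Fintype G] (H : Subgroup G) [Fintype H]
    (φ : G → ℂ) : ∑ g, (zetaTilde H g : ℂ) * φ g =
      ∑ h : H, ∑ k : G, φ ((h : G) * k * (h : G)⁻¹ * k⁻¹) := by
  classical
  rw [← Fintype.sum_prod_type' fun (h : H) (k : G) => φ ((h : G) * k * (h : G)⁻¹ * k⁻¹),
    ← Finset.sum_fiberwise _ (fun p : H × G => (p.1 : G) * p.2 * (p.1 : G)⁻¹ * p.2⁻¹)]
  refine Finset.sum_congr rfl fun g _ => ?_
  rw [Finset.sum_congr rfl fun p hp => congrArg φ (Finset.mem_filter.1 hp).2, Finset.sum_const,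
    nsmul_eq_mul, zetaTilde, Nat.card_eq_fintype_card, Fintype.card_subtype]

theorem zetaTilde_class_function_and_formula (G : Type) [Group G] [Fintype G]
    (H : Subgroup G) [H.Normal] [Fintype H]
    (ι : Type) [Fintype ι] (V : ι → FDRep ℂ G)
    (hsimple : ∀ i, Simple (V i))
    (hdistinct : ∀ i j, Nonempty (V i ≅ V j) → i = j)
    (hcomplete : ∀ W : FDRep ℂ G, Simple W → ∃ i, Nonempty (W ≅ V i)) :
    (∀ x g : G, zetaTilde H (x * g * x⁻¹) = zetaTilde H g) ∧
      ∀ g : G, (zetaTilde H g : ℂ) =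
        ∑ i, ((Nat.card H : ℂ) * restInner H ((V i).character) / (V i).character 1) *
          (V i).character g := by
  classical
  refine ⟨zetaTilde_conj H, fun g => ?_⟩
  have := invertibleOfNonzero (NeZero.ne (Nat.card G : ℂ))
  have hG : (Nat.card G : ℂ) ≠ 0 := NeZero.ne _
  have hH : (Nat.card H : ℂ) ≠ 0 := NeZero.ne _
  refine sub_eq_zero.1 (congrFun (class_function_eq_zero_of_orthogonal
    (fun g => (zetaTilde H g : ℂ) - ∑ i, ((Nat.card H : ℂ) * restInner H ((V i).character) /
      (V i).character 1) * (V i).character g) (fun x g => ?_) fun W hW => ?_) g)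
  · simp only [zetaTilde_conj, FDRep.char_conj]
  obtain ⟨i, ⟨e⟩⟩ := hcomplete W hW
  have horth : ∀ j, ∑ g, (V j).character g * (V i).character g⁻¹ =
      if j = i then (Nat.card G : ℂ) else 0 := fun j => by
    have := hsimple i
    have := hsimple j
    have h := FDRep.char_orthonormal (V j) (V i)
    rw [inv_mul_eq_iff_eq_mul₀ hG] at h
    rw [h]
    by_cases hji : j = i
    · subst hji
      simp [Nonempty.intro (Iso.refl (V j))]
    · simp [hji, mt (hdistinct j i) hji]
  have := hsimple i
  simp only [FDRep.char_iso e, sub_mul, Finset.sum_sub_distrib, Finset.sum_mul]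
  rw [sum_zetaTilde_mul H fun g => (V i).character g⁻¹, sub_eq_zero,
    Finset.sum_comm (s := (Finset.univ : Finset G)) (t := (Finset.univ : Finset ι))]
  simp_rw [mul_assoc _ ((V _).character _) ((V i).character _)]
  simp only [← Finset.mul_sum, horth, mul_ite, mul_zero, Finset.sum_ite_eq',
    Finset.mem_univ, if_true]
  have hcomm : ∀ h : H, ∑ k : G, (V i).character ((h : G) * k * (h : G)⁻¹ * k⁻¹)⁻¹ =
      Nat.card G * (V i).character h / (V i).character 1 * (V i).character (h : G)⁻¹ := fun h => by
    rw [← FDRep.sum_character_conj_mul]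
    simp [mul_assoc]
  simp only [hcomm, restInner, ← mul_assoc, mul_div_cancel₀ _ hH, one_mul,
    Finset.sum_div, Finset.sum_mul]
  exact Finset.sum_congr rfl fun h _ => by ring
end
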